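/- arXiv:1203.3961 — 2 statements merged into one kernel-verified Lean document; each statement's English description precedes it below -/
import Mathlib

section
/- For every nonnegative real m×n matrix S, psdrk(S) ≥ min{ rank(T) : T a real m×n matrix with supp(T) = supp(S) }. -/
open Matrix

/-- The positive semidefinite rank of a real `m × n` matrix `S`: the smallest `q`
such that there are real positive semidefinite `q × q` matrices `A k`, `B ℓ` with
`S k ℓ = tr((A k)ᵀ * B ℓ)` for all `k, ℓ`. -/
noncomputable def psdRank {m n : ℕ} (S : Matrix (Fin m) (Fin n) ℝ) : ℕ :=
  sInf {q : ℕ | ∃ (A : Fin m → Matrix (Fin q) (Fin q) ℝ)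
      (B : Fin n → Matrix (Fin q) (Fin q) ℝ),
    (∀ k, (A k).PosSemidef) ∧ (∀ ℓ, (B ℓ).PosSemidef) ∧
    ∀ k ℓ, S k ℓ = ((A k)ᵀ * B ℓ).trace}

open scoped MatrixOrder ComplexOrder in
/-- The trace of a product of two positive semidefinite matrices vanishes only if the product
does. -/
theorem Matrix.PosSemidef.trace_mul_eq_zero_iff {𝕜 ι : Type*} [RCLike 𝕜] [Fintype ι]
    {A B : Matrix ι ι 𝕜} (hA : A.PosSemidef) (hB : B.PosSemidef) :
    (A * B).trace = 0 ↔ A * B = 0 := by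
  classical
  refine ⟨fun h ↦ ?_, fun h ↦ by rw [h, trace_zero]⟩
  obtain ⟨U, rfl⟩ := CStarAlgebra.nonneg_iff_eq_star_mul_self.mp hA.nonneg
  obtain ⟨V, rfl⟩ := CStarAlgebra.nonneg_iff_eq_star_mul_self.mp hB.nonneg
  simp only [star_eq_conjTranspose] at h ⊢
  have hUV : ((U * Vᴴ)ᴴ * (U * Vᴴ)).trace = 0 := by
    rw [← h, ← Matrix.mul_assoc (Uᴴ * U), trace_mul_comm (Uᴴ * U * Vᴴ) V, conjTranspose_mul,
      conjTranspose_conjTranspose]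
    simp only [Matrix.mul_assoc]
  rw [conjTranspose_mul_self_mul_eq_zero, ← Matrix.mul_assoc,
    trace_conjTranspose_mul_self_eq_zero_iff.mp hUV, Matrix.zero_mul]

/-- Over an infinite field, some pair of vectors is not annihilated by any of finitely many given
nonzero bilinear forms. -/
theorem Matrix.exists_forall_dotProduct_mulVec_ne_zero {K ι p q : Type*} [Field K] [Infinite K]
    [Finite ι] [Fintype p] [Fintype q] (M : ι → Matrix p q K) (hM : ∀ i, M i ≠ 0) :
    ∃ a b, ∀ i, a ⬝ᵥ M i *ᵥ b ≠ 0 := by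
  classical
  obtain ⟨b, hb⟩ := Submodule.exists_forall_notMem_of_forall_ne_top
    (fun i ↦ LinearMap.ker (M i).mulVecLin) fun i h ↦ hM i <| by
      rw [LinearMap.ker_eq_top] at h
      exact Matrix.ext_of_mulVec_single fun j ↦ by
        simpa only [mulVecLin_apply, zero_mulVec] using! LinearMap.congr_fun h (Pi.single j 1)
  obtain ⟨a, ha⟩ := Module.Dual.exists_forall_ne_zero_of_forall_exists
    (fun i ↦ (dotProductBilin K K).flip (M i *ᵥ b)) fun i ↦ by
      by_contra! h
      exact hb i (dotProduct_eq_zero _ fun w ↦ by simpa [dotProduct_comm] using h w)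
  exact ⟨a, b, by simpa using ha⟩

/-- Every nonnegative matrix has a positive semidefinite factorization by diagonal matrices. -/
theorem exists_posSemidef_factorization {m n : ℕ} (S : Matrix (Fin m) (Fin n) ℝ)
    (hS : ∀ k ℓ, 0 ≤ S k ℓ) :
    ∃ (A : Fin m → Matrix (Fin m) (Fin m) ℝ) (B : Fin n → Matrix (Fin m) (Fin m) ℝ),
      (∀ k, (A k).PosSemidef) ∧ (∀ ℓ, (B ℓ).PosSemidef) ∧
      ∀ k ℓ, S k ℓ = ((A k)ᵀ * B ℓ).trace := by
  refine ⟨fun k ↦ diagonal (Pi.single k 1), fun ℓ ↦ diagonal fun k ↦ S k ℓ,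
    fun k ↦ .diagonal (Pi.single_nonneg.mpr zero_le_one), fun ℓ ↦ .diagonal fun k ↦ hS k ℓ,
    fun k ℓ ↦ ?_⟩
  simp [diagonal_mul_diagonal, trace_diagonal, Pi.single_apply]

/-- A positive semidefinite factorization of size `q` yields a matrix of rank at most `q` with the
same support. -/
theorem exists_same_support_rank_le {m n q : ℕ} {S : Matrix (Fin m) (Fin n) ℝ}
    {A : Fin m → Matrix (Fin q) (Fin q) ℝ} {B : Fin n → Matrix (Fin q) (Fin q) ℝ}
    (hA : ∀ k, (A k).PosSemidef) (hB : ∀ ℓ, (B ℓ).PosSemidef)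
    (hAB : ∀ k ℓ, S k ℓ = ((A k)ᵀ * B ℓ).trace) :
    ∃ T : Matrix (Fin m) (Fin n) ℝ, (∀ k ℓ, T k ℓ = 0 ↔ S k ℓ = 0) ∧ T.rank ≤ q := by
  obtain ⟨a, b, hab⟩ := exists_forall_dotProduct_mulVec_ne_zero
    (fun i : {i : Fin m × Fin n // (A i.1)ᵀ * B i.2 ≠ 0} ↦ (A i.1.1)ᵀ * B i.1.2) fun i ↦ i.2
  let X : Matrix (Fin m) (Fin q) ℝ := of fun k ↦ a ᵥ* (A k)ᵀ
  let Y : Matrix (Fin q) (Fin n) ℝ := of fun i ℓ ↦ (B ℓ *ᵥ b) i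
  have hXY k ℓ : (X * Y) k ℓ = a ⬝ᵥ ((A k)ᵀ * B ℓ) *ᵥ b := by
    rw [← mulVec_mulVec, dotProduct_mulVec]
    rfl
  refine ⟨X * Y, fun k ℓ ↦ ?_, (rank_mul_le_left X Y).trans (rank_le_width X)⟩
  rw [hAB, (hA k).transpose.trace_mul_eq_zero_iff (hB ℓ), hXY]
  refine ⟨fun h ↦ ?_, fun h ↦ by simp [h]⟩
  by_contra h0
  exact hab ⟨(k, ℓ), h0⟩ h

theorem psdRank_ge_min_rank_of_support {m n : ℕ} (S : Matrix (Fin m) (Fin n) ℝ)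
    (hS : ∀ k ℓ, 0 ≤ S k ℓ) :
    sInf {q : ℕ | ∃ T : Matrix (Fin m) (Fin n) ℝ,
        (∀ k ℓ, T k ℓ = 0 ↔ S k ℓ = 0) ∧ T.rank = q} ≤ psdRank S := by
  refine le_csInf ⟨m, exists_posSemidef_factorization S hS⟩ ?_
  rintro q ⟨A, B, hA, hB, hAB⟩
  obtain ⟨T, hT, hrank⟩ := exists_same_support_rank_le hA hB hAB
  exact le_trans (Nat.sInf_le ⟨T, hT, rfl⟩) hrank
end

section
/- For every n ≥ 6, the n×n nonnegative real matrix S_n defined by S_n(i,j) = (i−j−1)(i−j−2)/2 satisfies psdrk(S_n) ≥ 4. -/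
open Matrix

/-- The `n × n` matrix with entries `S_n(i,j) = (i-j-1)(i-j-2)/2` for
`1 ≤ i, j ≤ n` (here row `i` corresponds to `Fin n` element `i - 1`). -/
noncomputable def Smat (n : ℕ) : Matrix (Fin n) (Fin n) ℝ := fun i j =>
  (((i : ℕ) : ℝ) - ((j : ℕ) : ℝ) - 1) * (((i : ℕ) : ℝ) - ((j : ℕ) : ℝ) - 2) / 2

/-- Every nonnegative matrix has a psd factorization, by diagonal matrices. -/
lemma exists_psd_factorization {m n : ℕ} (S : Matrix (Fin m) (Fin n) ℝ)
    (hS : ∀ k ℓ, 0 ≤ S k ℓ) :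
    ∃ (A : Fin m → Matrix (Fin n) (Fin n) ℝ) (B : Fin n → Matrix (Fin n) (Fin n) ℝ),
      (∀ k, (A k).PosSemidef) ∧ (∀ ℓ, (B ℓ).PosSemidef) ∧
      ∀ k ℓ, S k ℓ = ((A k)ᵀ * B ℓ).trace := by
  refine ⟨fun k => diagonal (S k), fun ℓ => diagonal (Pi.single ℓ 1), fun k => ?_, fun ℓ => ?_,
    fun k ℓ => ?_⟩
  · exact posSemidef_diagonal_iff.2 (hS k)
  · refine posSemidef_diagonal_iff.2 fun i => ?_
    by_cases h : i = ℓ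
    · subst h; simp
    · simp [Pi.single_eq_of_ne h]
  · simp [diagonal_transpose, diagonal_mul_diagonal, trace_diagonal, Pi.single_apply]

lemma Smat_nonneg (n : ℕ) (i j : Fin n) : 0 ≤ Smat n i j := by
  have h : (0 : ℤ) ≤ ((i : ℕ) - (j : ℕ) - 1) * ((i : ℕ) - (j : ℕ) - 2) := by
    rcases le_or_gt ((i : ℕ) : ℤ) ((j : ℕ) + 1) with h | h
    · exact mul_nonneg_of_nonpos_of_nonpos (by omega) (by omega)
    · exact mul_nonneg (by omega) (by omega)
  have h' : (0 : ℝ) ≤ ((i : ℕ) - (j : ℕ) - 1) * ((i : ℕ) - (j : ℕ) - 2) := by exact_mod_cast h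
  exact div_nonneg h' zero_le_two

namespace Matrix.PosSemidef

variable {ι : Type*} [Fintype ι] {A B C : Matrix ι ι ℝ}

lemma exists_eq_transpose_mul_self (hA : A.PosSemidef) : ∃ M : Matrix ι ι ℝ, A = Mᵀ * M := by
  classical
  open scoped MatrixOrder in
  obtain ⟨M, hM⟩ := CStarAlgebra.nonneg_iff_eq_star_mul_self.mp hA.nonneg
  exact ⟨M, by simpa [star_eq_conjTranspose] using hM⟩

lemma mul_eq_zero_of_trace_mul_eq_zero (hA : A.PosSemidef) (hB : B.PosSemidef)
    (h : (A * B).trace = 0) : A * B = 0 := by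
  obtain ⟨M, rfl⟩ := hA.exists_eq_transpose_mul_self
  obtain ⟨N, rfl⟩ := hB.exists_eq_transpose_mul_self
  have h₀ : ((M * Nᵀ)ᴴ * (M * Nᵀ)).trace = 0 := by
    rw [← h, conjTranspose_eq_transpose_of_trivial, transpose_mul, transpose_transpose,
      Matrix.mul_assoc, trace_mul_comm]
    simp only [Matrix.mul_assoc]
  have h₁ : M * Nᵀ = 0 := trace_conjTranspose_mul_self_eq_zero_iff.1 h₀
  rw [Matrix.mul_assoc, ← Matrix.mul_assoc M, h₁, Matrix.zero_mul, Matrix.mul_zero]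

lemma exists_eq_vecMulVec_self (hA : A.PosSemidef) (h : A.rank ≤ 1) :
    ∃ a : ι → ℝ, A = vecMulVec a a := by
  obtain ⟨M, rfl⟩ := hA.exists_eq_transpose_mul_self
  rw [rank_transpose_mul_self, rank_eq_finrank_span_row, finrank_le_one_iff] at h
  obtain ⟨v, hv⟩ := h
  choose c hc using fun i => hv ⟨M.row i, Submodule.subset_span ⟨i, rfl⟩⟩
  have hM : ∀ i j, M i j = c i * (v : ι → ℝ) j := fun i j =>
    (congrFun (congrArg Subtype.val (hc i)) j).symm
  refine ⟨√(∑ i, c i * c i) • (v : ι → ℝ), ?_⟩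
  have hs := Real.mul_self_sqrt (Finset.sum_nonneg fun i (_ : i ∈ Finset.univ) =>
    mul_self_nonneg (c i))
  ext i j
  simp only [mul_apply, transpose_apply, hM, vecMulVec_apply, Pi.smul_apply, smul_eq_mul]
  rw [mul_mul_mul_comm, hs, Finset.sum_mul]
  exact Finset.sum_congr rfl fun k _ => by ring

/-- If `A` is orthogonal to `B` and `B'`, and `C` is orthogonal to `B ≠ 0` but not to `B'`, then
the kernel of `A` has dimension at least two. -/
lemma rank_add_two_le {B' : Matrix ι ι ℝ} (hA : A.PosSemidef) (hC : C.PosSemidef)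
    (hB : B.PosSemidef) (hB' : B'.PosSemidef) (hAB : (A * B).trace = 0)
    (hAB' : (A * B').trace = 0) (hCB : (C * B).trace = 0) (hCB' : (C * B').trace ≠ 0)
    (hB0 : B ≠ 0) : A.rank + 2 ≤ Fintype.card ι := by
  classical
  have eAB := hA.mul_eq_zero_of_trace_mul_eq_zero hB hAB
  have eAB' := hA.mul_eq_zero_of_trace_mul_eq_zero hB' hAB'
  have eCB := hC.mul_eq_zero_of_trace_mul_eq_zero hB hCB
  have nCB' : C * B' ≠ 0 := fun h => hCB' (by rw [h, trace_zero])
  obtain ⟨x, hx⟩ : ∃ x, B *ᵥ x ≠ 0 := by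
    by_contra! h
    exact hB0 (Matrix.ext_of_mulVec_single fun i => by rw [h, zero_mulVec])
  obtain ⟨y, hy⟩ : ∃ y, (C * B') *ᵥ y ≠ 0 := by
    by_contra! h
    exact nCB' (Matrix.ext_of_mulVec_single fun i => by rw [h, zero_mulVec])
  have hli : LinearIndependent ℝ ![B *ᵥ x, B' *ᵥ y] := by
    rw [LinearIndependent.pair_iff' hx]
    intro a ha
    apply hy
    rw [← mulVec_mulVec, ← ha, mulVec_smul, mulVec_mulVec, eCB, zero_mulVec, smul_zero]
  have hspan : Submodule.span ℝ (Set.range ![B *ᵥ x, B' *ᵥ y]) ≤ LinearMap.ker A.mulVecLin := by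
    rw [Submodule.span_le]
    rintro _ ⟨i, rfl⟩
    fin_cases i
    · simp [mulVec_mulVec, eAB]
    · simp [mulVec_mulVec, eAB']
  have h2 := Submodule.finrank_mono hspan
  rw [finrank_span_eq_card hli, Fintype.card_fin] at h2
  have h3 := A.mulVecLin.finrank_range_add_finrank_ker
  rw [Module.finrank_fintype_fun_eq_card] at h3
  rw [Matrix.rank]
  omega

end Matrix.PosSemidef

/-- A `4 × 4` matrix whose entrywise square is the central submatrix of `Smat 6` is invertible. -/
lemma det_ne_zero_of_sq (T : Matrix (Fin 4) (Fin 4) ℝ)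
    (h : ∀ i j, T i j ^ 2 =
      (!![0, 0, 1, 3; 1, 0, 0, 1; 3, 1, 0, 0; 6, 3, 1, 0] : Matrix (Fin 4) (Fin 4) ℝ) i j) :
    T.det ≠ 0 := by
  intro hdet
  have h00 : T 0 0 = 0 := by simpa using h 0 0
  have h01 : T 0 1 = 0 := by simpa using h 0 1
  have h02 : T 0 2 ^ 2 = 1 := by simpa using h 0 2
  have h03 : T 0 3 ^ 2 = 3 := by simpa using h 0 3
  have h10 : T 1 0 ^ 2 = 1 := by simpa using h 1 0
  have h11 : T 1 1 = 0 := by simpa using h 1 1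
  have h12 : T 1 2 = 0 := by simpa using h 1 2
  have h13 : T 1 3 ^ 2 = 1 := by simpa using h 1 3
  have h20 : T 2 0 ^ 2 = 3 := by simpa using h 2 0
  have h21 : T 2 1 ^ 2 = 1 := by simpa using h 2 1
  have h22 : T 2 2 = 0 := by simpa using h 2 2
  have h23 : T 2 3 = 0 := by simpa using h 2 3
  have h30 : T 3 0 ^ 2 = 6 := by simpa using h 3 0
  have h31 : T 3 1 ^ 2 = 3 := by simpa using h 3 1
  have h32 : T 3 2 ^ 2 = 1 := by simpa using h 3 2
  have h33 : T 3 3 = 0 := by simpa using h 3 3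
  obtain ⟨P, hP⟩ : ∃ P, P = T 0 2 * T 1 3 * T 2 0 * T 3 1 := ⟨_, rfl⟩
  obtain ⟨Q, hQ⟩ : ∃ Q, Q = T 0 2 * T 1 3 * T 2 1 * T 3 0 := ⟨_, rfl⟩
  obtain ⟨R, hR⟩ : ∃ R, R = T 0 3 * T 1 0 * T 2 1 * T 3 2 := ⟨_, rfl⟩
  have hP2 : P ^ 2 = 9 := by rw [hP]; simp only [mul_pow, h02, h13, h20, h31]; norm_num
  have hQ2 : Q ^ 2 = 6 := by rw [hQ]; simp only [mul_pow, h02, h13, h21, h30]; norm_num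
  have hR2 : R ^ 2 = 3 := by rw [hR]; simp only [mul_pow, h03, h10, h21, h32]; norm_num
  have hsum : P - Q - R = 0 := by
    rw [← hdet, hP, hQ, hR]
    simp [det_succ_row_zero, Fin.sum_univ_succ, Fin.succAbove, h00, h01, h11, h12, h22, h23, h33]
    ring
  have hPQ : P * Q = 6 := by
    have hR' : R = P - Q := by linarith
    rw [hR'] at hR2
    linarith [sub_sq P Q]
  have : (P * Q) ^ 2 = 54 := by rw [mul_pow, hP2, hQ2]; norm_num
  rw [hPQ] at this
  norm_num at this

lemma det_of_dotProduct_eq_zero {p q : ℕ} (h : q < p) (a b : Fin p → Fin q → ℝ) :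
    (Matrix.of fun i j => a i ⬝ᵥ b j).det = 0 := by
  by_contra hdet
  have h1 := rank_of_det_ne_zero hdet
  have h2 : (Matrix.of fun i j => a i ⬝ᵥ b j) = Matrix.of a * (Matrix.of b)ᵀ := by
    ext i j; simp [mul_apply, dotProduct]
  have h3 := (rank_mul_le_left (Matrix.of a) (Matrix.of b)ᵀ).trans (rank_le_width _)
  rw [← h2, h1, Fintype.card_fin] at h3
  omega

theorem psdRank_Smat_ge_four (n : ℕ) (hn : 6 ≤ n) : 4 ≤ psdRank (Smat n) := by
  refine le_csInf ⟨n, exists_psd_factorization _ (Smat_nonneg n)⟩ ?_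
  rintro q ⟨A, B, hA, hB, hS⟩
  by_contra! hq
  have hval : ∀ (i j : ℕ) (hi : i < n) (hj : j < n), (A ⟨i, hi⟩ * B ⟨j, hj⟩).trace =
      ((i : ℝ) - j - 1) * (i - j - 2) / 2 := fun i j hi hj => by
    have h := hS ⟨i, hi⟩ ⟨j, hj⟩
    rw [← conjTranspose_eq_transpose_of_trivial, (hA _).isHermitian.eq] at h
    simpa [Smat] using h.symm
  have hA0 : ∀ (i : ℕ) (hi : i < n), A ⟨i, hi⟩ ≠ 0 := fun i hi h => by
    have := hval i i hi hi
    rw [h] at this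
    norm_num at this
  have hB0 : ∀ (i : ℕ) (hi : i < n), B ⟨i, hi⟩ ≠ 0 := fun i hi h => by
    have := hval i i hi hi
    rw [h] at this
    norm_num at this
  have hrow : ∀ i : Fin 4, ∃ a, A ⟨i + 2, by omega⟩ = vecMulVec a a := fun i => by
    refine (hA _).exists_eq_vecMulVec_self ?_
    have := (hA ⟨i + 2, by omega⟩).rank_add_two_le (hA ⟨i + 1, by omega⟩) (hB ⟨i, by omega⟩)
      (hB ⟨i + 1, by omega⟩) (by rw [hval]; push_cast; ring) (by rw [hval]; push_cast; ring)
      (by rw [hval]; push_cast; ring) (by rw [hval]; push_cast; ring_nf; norm_num) (hB0 _ _)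
    rw [Fintype.card_fin] at this
    omega
  have hcol : ∀ j : Fin 4, ∃ b, B ⟨j, by omega⟩ = vecMulVec b b := fun j => by
    refine (hB _).exists_eq_vecMulVec_self ?_
    have := (hB ⟨j, by omega⟩).rank_add_two_le (hB ⟨j + 1, by omega⟩) (hA ⟨j + 2, by omega⟩)
      (hA ⟨j + 1, by omega⟩) (by rw [trace_mul_comm, hval]; push_cast; ring)
      (by rw [trace_mul_comm, hval]; push_cast; ring)
      (by rw [trace_mul_comm, hval]; push_cast; ring)
      (by rw [trace_mul_comm, hval]; push_cast; ring_nf; norm_num) (hA0 _ _)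
    rw [Fintype.card_fin] at this
    omega
  choose a ha using hrow
  choose b hb using hcol
  refine det_ne_zero_of_sq _ (fun i j => ?_) (det_of_dotProduct_eq_zero hq a b)
  have h := hval (i + 2) j (by omega) (by omega)
  rw [ha, hb, vecMulVec_mul_vecMulVec, trace_vecMulVec, dotProduct_smul, smul_eq_mul, ← sq] at h
  rw [of_apply, h]
  fin_cases i <;> fin_cases j <;> norm_num
end
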